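/- Let (A_S,S) be an Artin-Tits system, X ⊆ S and t ∈ S such that the indecomposable component X(t) of X∪{t} containing t is of spherical type. Set d_{X,t} = Δ_{X(t)}Δ_{X(t)−{t}}⁻¹ if t ∉ X and d_{X,t} = Δ_{X(t)} if t ∈ X. Then there exists a unique subset Y ⊆ X∪{t} such that Y·d_{X,t} = d_{X,t}·X (equality of the subsets {s·d_{X,t} : s∈Y} and {d_{X,t}·s : s∈X} of A_S). -/

import Mathlib

/-!
Common definitions for formalizing "Normalisateur des sous-groupes paraboliques
des groupes d'Artin-Tits" (E. Godelle).

We fix a Coxeter matrix `M` over a finite index set `B` (Mathlib's convention: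
`M s t = 0` encodes `m_{s,t} = ∞`).  The Artin-Tits group `Artin M` is the
presented group on the braid relations, the Coxeter group is Mathlib's
`M.Group`, and `proj : Artin M →* M.Group` is the canonical projection
(adding the relations `s² = 1`).
-/

namespace ArtinTitsPaper

open List

variable {B : Type*}

/-- The alternating list `[s, t, s, t, ...]` with `n` terms, starting with `s`. -/
def altList (s t : B) : ℕ → List B
  | 0 => []
  | n + 1 => s :: altList t s n

/-- The braid relators `(sts⋯)(tst⋯)⁻¹` (`m_{s,t}` letters each) for `s ≠ t`,
`m_{s,t} ≠ ∞`. -/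
def braidRels (M : CoxeterMatrix B) : Set (FreeGroup B) :=
  { r | ∃ s t : B, s ≠ t ∧ M s t ≠ 0 ∧
      r = ((altList s t (M s t)).map FreeGroup.of).prod *
          (((altList t s (M s t)).map FreeGroup.of).prod)⁻¹ }

/-- The Artin-Tits group associated to the Coxeter matrix `M`. -/
def Artin (M : CoxeterMatrix B) : Type _ := PresentedGroup (braidRels M)

instance (M : CoxeterMatrix B) : Group (Artin M) :=
  QuotientGroup.Quotient.group _

/-- The standard generator of `Artin M` indexed by `s : B` (the image of `S` in `A_S`). -/
def gen (M : CoxeterMatrix B) (s : B) : Artin M := PresentedGroup.of s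

theorem altList_eq_reverse_alternatingWord (s t : B) (n : ℕ) :
    altList s t n = (CoxeterSystem.alternatingWord t s n).reverse := by
  induction n generalizing s t with
  | zero => rfl
  | succ n ih =>
      rw [altList, CoxeterSystem.alternatingWord_succ, List.concat_eq_append,
        List.reverse_append]
      simp [ih]

theorem lift_simple_listProd (M : CoxeterMatrix B) (l : List B) :
    FreeGroup.lift M.simple ((l.map FreeGroup.of).prod) =
      M.toCoxeterSystem.wordProd l := by
  rw [CoxeterSystem.wordProd, map_list_prod, List.map_map]
  simp [Function.comp_def, CoxeterMatrix.toCoxeterSystem_simple]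

theorem braid_lift (M : CoxeterMatrix B) :
    ∀ r ∈ braidRels M, FreeGroup.lift M.simple r = 1 := by
  rintro r ⟨s, t, hst, hm, rfl⟩
  rw [map_mul, map_inv, lift_simple_listProd, lift_simple_listProd,
    altList_eq_reverse_alternatingWord, altList_eq_reverse_alternatingWord,
    CoxeterSystem.wordProd_reverse, CoxeterSystem.wordProd_reverse]
  have hsym : M s t = M t s := M.symmetric s t
  have hb := M.toCoxeterSystem.wordProd_braidWord_eq t s
  rw [CoxeterSystem.braidWord, CoxeterSystem.braidWord, ← hsym] at hb
  rw [hb]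
  simp

/-- The canonical projection from the Artin-Tits group onto the Coxeter group
(adding the relations `s² = 1`). -/
def proj (M : CoxeterMatrix B) : Artin M →* M.Group :=
  PresentedGroup.toGroup (braid_lift M)

/-- The positive monoid `A_S⁺`, the submonoid of `A_S` generated by `S`. -/
def posMon (M : CoxeterMatrix B) : Submonoid (Artin M) :=
  Submonoid.closure (Set.range (gen M))

/-- The submonoid `A_X⁺` of `A_S` generated by `X ⊆ S`. -/
def posMonOn (M : CoxeterMatrix B) (X : Set B) : Submonoid (Artin M) :=
  Submonoid.closure (gen M '' X)

/-- The standard parabolic subgroup `A_X` of `A_S` generated by `X ⊆ S`. -/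
def stdSub (M : CoxeterMatrix B) (X : Set B) : Subgroup (Artin M) :=
  Subgroup.closure (gen M '' X)

/-- The standard parabolic subgroup `W_X` of the Coxeter group `W_S`. -/
def coxSub (M : CoxeterMatrix B) (X : Set B) : Subgroup M.Group :=
  Subgroup.closure (M.simple '' X)

/-- `X ⊆ S` is of spherical type if the Coxeter group `W_X` is finite. -/
def IsSpherical (M : CoxeterMatrix B) (X : Set B) : Prop :=
  Finite (coxSub M X)

/-- `a` left-divides `b` in the positive monoid: `b = a c` with `c ∈ A_S⁺`. -/
def ldvd (M : CoxeterMatrix B) (a b : Artin M) : Prop :=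
  ∃ c ∈ posMon M, a * c = b

/-- `a` right-divides `b` in the positive monoid: `b = c a` with `c ∈ A_S⁺`. -/
def rdvd (M : CoxeterMatrix B) (a b : Artin M) : Prop :=
  ∃ c ∈ posMon M, c * a = b

/-- `d` is the least common multiple `Δ_X` of `X` in `A_X⁺` (for left-divisibility). -/
def IsDelta (M : CoxeterMatrix B) (X : Set B) (d : Artin M) : Prop :=
  d ∈ posMonOn M X ∧
  (∀ s ∈ X, ∃ c ∈ posMonOn M X, gen M s * c = d) ∧
  ∀ m ∈ posMonOn M X, (∀ s ∈ X, ∃ c ∈ posMonOn M X, gen M s * c = m) →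
    ∃ c ∈ posMonOn M X, d * c = m

/-- The subset `Xg = {σ_x g : x ∈ X}` of `A_S`. -/
def leftMul (M : CoxeterMatrix B) (X : Set B) (g : Artin M) : Set (Artin M) :=
  (fun x => gen M x * g) '' X

/-- The subset `gX = {g σ_x : x ∈ X}` of `A_S`. -/
def rightMul (M : CoxeterMatrix B) (X : Set B) (g : Artin M) : Set (Artin M) :=
  (fun x => g * gen M x) '' X

/-- `Conj(S;X,Y) = {g ∈ A_S : gX = Yg}`. -/
def conjSet (M : CoxeterMatrix B) (X Y : Set B) : Set (Artin M) :=
  { g | rightMul M X g = leftMul M Y g }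

/-- `Conj⁺(S;X,Y) = {g ∈ A_S⁺ : gX = Yg}`. -/
def conjPos (M : CoxeterMatrix B) (X Y : Set B) : Set (Artin M) :=
  { g | g ∈ posMon M ∧ rightMul M X g = leftMul M Y g }

/-- The quasi-centralizer `QZ_{A_S}(A_X) = {g ∈ A_S : gX = Xg}`. -/
def QZset (M : CoxeterMatrix B) (X : Set B) : Set (Artin M) :=
  conjSet M X X

/-- The indecomposable component of `Z` containing `t` (vertices of `Z` joined to `t`
by a path of edges `m_{a,b} ≠ 2` in the Coxeter diagram on `Z`). -/
def comp (M : CoxeterMatrix B) (Z : Set B) (t : B) : Set B :=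
  { s ∈ Z | Relation.ReflTransGen (fun a b => a ∈ Z ∧ b ∈ Z ∧ a ≠ b ∧ M a b ≠ 2) t s }

/-- `Z` is indecomposable: it admits no nontrivial partition `Z = Z₁ ∪ Z₂` with
`m_{a,b} = 2` for `a ∈ Z₁`, `b ∈ Z₂`. -/
def Indecomp (M : CoxeterMatrix B) (Z : Set B) : Prop :=
  ¬ ∃ Z₁ Z₂ : Set B, Z₁.Nonempty ∧ Z₂.Nonempty ∧ Z₁ ∪ Z₂ = Z ∧ Disjoint Z₁ Z₂ ∧
      ∀ a ∈ Z₁, ∀ b ∈ Z₂, M a b = 2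

/-- `g` is an elementary positive `Y`-ribbon-`X`: `g = d_{X,t}` for some `t ∈ S` with
`X(t)` of spherical type, where `d_{X,t} = Δ_{X(t)}` if `t ∈ X` and
`d_{X,t} = Δ_{X(t)} Δ_{X(t)∖{t}}⁻¹` otherwise, and `Y ⊆ X ∪ {t}` satisfies `Yg = gX`. -/
def IsElemRibbon (M : CoxeterMatrix B) (X Y : Set B) (g : Artin M) : Prop :=
  ∃ t : B, IsSpherical M (comp M (X ∪ {t}) t) ∧
    ((t ∈ X ∧ IsDelta M (comp M (X ∪ {t}) t) g) ∨
      (t ∉ X ∧ ∃ d₁ d₂ : Artin M, IsDelta M (comp M (X ∪ {t}) t) d₁ ∧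
        IsDelta M ((comp M (X ∪ {t}) t) \ {t}) d₂ ∧ g = d₁ * d₂⁻¹)) ∧
    Y ⊆ X ∪ {t} ∧ leftMul M Y g = rightMul M X g

/-- `g` is a positive `Y`-ribbon-`X`: a product `g = g_n ⋯ g_1` of elementary positive
`X_i`-ribbons-`X_{i-1}` with `X_0 = X`, `X_n = Y`. -/
inductive IsRibbon (M : CoxeterMatrix B) : Set B → Set B → Artin M → Prop
  | nil (X : Set B) : IsRibbon M X X 1
  | cons {X Y Z : Set B} {g h : Artin M} :
      IsRibbon M X Y g → IsElemRibbon M Y Z h → IsRibbon M X Z (h * g)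

/-- `g` is `X`-reduced: no element of `X` left-divides `g`. -/
def lreduced (M : CoxeterMatrix B) (X : Set B) (g : Artin M) : Prop :=
  ∀ s ∈ X, ¬ ldvd M (gen M s) g

/-- `g` is reduced-`X`: no element of `X` right-divides `g`. -/
def rreduced (M : CoxeterMatrix B) (X : Set B) (g : Artin M) : Prop :=
  ∀ s ∈ X, ¬ rdvd M (gen M s) g

/-- The set `H_X` of elements `g₁ g₂⁻¹` where `g₁, g₂` are `X`-reduced positive
`X`-ribbons-`X`. -/
def HXset (M : CoxeterMatrix B) (X : Set B) : Set (Artin M) :=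
  { g | ∃ g₁ g₂ : Artin M, IsRibbon M X X g₁ ∧ lreduced M X g₁ ∧
      IsRibbon M X X g₂ ∧ lreduced M X g₂ ∧ g = g₁ * g₂⁻¹ }

/-- The length of a positive element (the common length of its expressions as words
in the generators; junk value `0` outside of `A_S⁺`). -/
noncomputable def len (M : CoxeterMatrix B) (g : Artin M) : ℕ :=
  sInf { n | ∃ l : List B, l.length = n ∧ (l.map (gen M)).prod = g }

/-- The length of an element of the Coxeter group `W_S`. -/
noncomputable def wlen (M : CoxeterMatrix B) (w : M.Group) : ℕ :=
  sInf { n | ∃ l : List B, l.length = n ∧ (l.map M.simple).prod = w }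

/-- `g ∈ A_{S,red}`: `g` is positive and has the same length as its image in `W_S`. -/
def Red (M : CoxeterMatrix B) (g : Artin M) : Prop :=
  g ∈ posMon M ∧ len M g = wlen M (proj M g)

/-- `C` is a simple `s`-chain-`u`: either `C = 1` and `s = u`, or
`C = tst⋯` (`k` letters, `k < m_{s,t}`) with `u ∈ {s,t}` and `C·u = tst⋯` (`k+1` letters). -/
def IsSimpleChain (M : CoxeterMatrix B) (s u : B) (C : Artin M) : Prop :=
  (C = 1 ∧ s = u) ∨
  ∃ t : B, t ≠ s ∧ (u = s ∨ u = t) ∧ ∃ k : ℕ,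
    (M s t = 0 ∨ k < M s t) ∧
    C = ((altList t s k).map (gen M)).prod ∧
    C * gen M u = ((altList t s (k + 1)).map (gen M)).prod

/-- `C` is an `s`-chain-`t`: a product `C₁ ⋯ C_k` of simple chains composing from
origin `s` to target `t`. -/
inductive IsChain (M : CoxeterMatrix B) : B → B → Artin M → Prop
  | single {s u : B} {C : Artin M} : IsSimpleChain M s u C → IsChain M s u C
  | comp {s u v : B} {C D : Artin M} :
      IsChain M s u C → IsSimpleChain M u v D → IsChain M s v (C * D)

section GeometricRepresentation

open Polynomial.Chebyshev Module

/-- The functional `v ↦ 2 ⟨α_i, v⟩` of the geometric representation. -/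
noncomputable def corootFunctional (M : CoxeterMatrix B) (i : B) : Dual ℝ (B →₀ ℝ) :=
  Finsupp.linearCombination ℝ fun j => -2 * Real.cos (Real.pi / M i j)

theorem corootFunctional_single (M : CoxeterMatrix B) (i j : B) :
    corootFunctional M i (Finsupp.single j 1) = -2 * Real.cos (Real.pi / M i j) := by
  simp [corootFunctional]

theorem corootFunctional_self (M : CoxeterMatrix B) (i : B) :
    corootFunctional M i (Finsupp.single i 1) = 2 := by
  simp [corootFunctional_single]

/-- The reflection attached to a simple root in the geometric representation. -/
noncomputable def simpleReflection (M : CoxeterMatrix B) (i : B) :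
    (B →₀ ℝ) ≃ₗ[ℝ] (B →₀ ℝ) :=
  reflection (corootFunctional_self M i)

theorem coroot_mul_coroot_sub_two (M : CoxeterMatrix B) (i j : B) :
    corootFunctional M i (Finsupp.single j 1) * corootFunctional M j (Finsupp.single i 1) - 2 =
      2 * Real.cos (2 * Real.pi / M i j) := by
  rw [corootFunctional_single, corootFunctional_single, M.symmetric j i, mul_div_assoc,
    Real.cos_two_mul]
  ring

theorem sin_two_pi_div_pos {m : ℕ} (hm : 3 ≤ m) : 0 < Real.sin (2 * Real.pi / m) := by
  have h3 : (3 : ℝ) ≤ m := by exact_mod_cast hm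
  apply Real.sin_pos_of_pos_of_lt_pi
  · positivity
  · rw [div_lt_iff₀ (by linarith)]
    nlinarith [Real.pi_pos]

theorem simpleReflection_isLiftable (M : CoxeterMatrix B) :
    M.IsLiftable (simpleReflection M) := by
  intro i j
  rcases eq_or_ne i j with rfl | hij
  · rw [M.diagonal, pow_one]
    ext1 v
    rw [LinearEquiv.mul_apply, simpleReflection, involutive_reflection, LinearEquiv.coe_one, id_eq]
  have h1 : M i j ≠ 1 := M.off_diagonal i j hij
  rcases Nat.lt_or_ge (M i j) 3 with hlt | hge
  · have h02 : M i j = 0 ∨ M i j = 2 := by omega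
    rcases h02 with h0 | h2
    · rw [h0, pow_zero]
    · have hi : corootFunctional M i (Finsupp.single j 1) = 0 := by
        simp [corootFunctional_single, h2]
      have hj : corootFunctional M j (Finsupp.single i 1) = 0 := by
        simp [corootFunctional_single, M.symmetric j i, h2]
      rw [h2, pow_two]
      ext1 v
      simp only [LinearEquiv.mul_apply, simpleReflection, reflection_apply, map_sub, map_smul,
        hi, hj, corootFunctional_self, LinearEquiv.coe_one, id_eq]
      module
  · have hs := sin_two_pi_div_pos hge
    have hm0 : (M i j : ℝ) ≠ 0 := by positivity
    have key := fun n : ℤ => S_two_mul_real_cos (2 * Real.pi / M i j) n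
    ext1 v
    rw [simpleReflection, simpleReflection,
      reflection_mul_reflection_pow_apply (corootFunctional_self M i) (corootFunctional_self M j)
        (M i j) v _ (coroot_mul_coroot_sub_two M i j).symm]
    rcases Nat.even_or_odd' (M i j) with ⟨k, hk | hk⟩
    · have e1 : ((M i j : ℤ) - 2) / 2 = k - 1 := by omega
      have e2 : ((M i j : ℤ) - 1) / 2 = k - 1 := by omega
      have hz : (S ℝ ((k : ℤ) - 1)).eval (2 * Real.cos (2 * Real.pi / M i j)) = 0 := by
        have := key (k - 1)
        have hk' : (M i j : ℝ) = 2 * k := by exact_mod_cast hk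
        have ha : (((k - 1 : ℤ) : ℝ) + 1) * (2 * Real.pi / M i j) = Real.pi := by
          push_cast
          field_simp
          rw [hk']; ring
        rw [ha, Real.sin_pi] at this
        exact (mul_eq_zero.mp this).resolve_right hs.ne'
      rw [e1, e2, hz]
      simp
    · have e1 : ((M i j : ℤ) - 2) / 2 = k - 1 := by omega
      have e2 : ((M i j : ℤ) - 1) / 2 = k := by omega
      have e3 : ((M i j : ℤ) - 3) / 2 = k - 1 := by omega
      have e4 : ((M i j : ℤ)) / 2 = k := by omega
      have hz : (S ℝ (k : ℤ)).eval (2 * Real.cos (2 * Real.pi / M i j)) +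
          (S ℝ ((k : ℤ) - 1)).eval (2 * Real.cos (2 * Real.pi / M i j)) = 0 := by
        have h1 := key k
        have h2 := key (k - 1)
        have hk' : (M i j : ℝ) = 2 * k + 1 := by exact_mod_cast hk
        have ha : (((k : ℤ) : ℝ) + 1) * (2 * Real.pi / M i j) =
            2 * Real.pi - (((k - 1 : ℤ) : ℝ) + 1) * (2 * Real.pi / M i j) := by
          push_cast
          field_simp
          rw [hk']; ring
        rw [ha, Real.sin_two_pi_sub] at h1
        have : ((S ℝ (k : ℤ)).eval (2 * Real.cos (2 * Real.pi / M i j)) +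
          (S ℝ ((k : ℤ) - 1)).eval (2 * Real.cos (2 * Real.pi / M i j))) *
            Real.sin (2 * Real.pi / M i j) = 0 := by
          rw [add_mul, h1, h2]; ring
        exact (mul_eq_zero.mp this).resolve_right hs.ne'
      rw [e1, e2, e3, e4, hz]
      simp

theorem simpleReflection_mul_pow_ne_one (M : CoxeterMatrix B) {i j : B} (hij : i ≠ j) {n : ℕ}
    (hn : 0 < n) (hnm : M i j = 0 ∨ n < M i j) :
    (simpleReflection M i * simpleReflection M j) ^ n ≠ 1 := by
  intro h
  have happ := congrArg (fun e : (B →₀ ℝ) ≃ₗ[ℝ] (B →₀ ℝ) => e (Finsupp.single i 1)) h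
  simp only [simpleReflection] at happ
  rw [reflection_mul_reflection_pow_apply_self (corootFunctional_self M i)
    (corootFunctional_self M j) n _ (coroot_mul_coroot_sub_two M i j).symm] at happ
  have hci := congrArg (fun v : B →₀ ℝ => v i) happ
  have hcj := congrArg (fun v : B →₀ ℝ => v j) happ
  have h1 : M i j ≠ 1 := M.off_diagonal i j hij
  simp [hij, hij.symm, corootFunctional_single, M.symmetric j i] at hci hcj
  rcases Nat.lt_or_ge (M i j) 3 with hlt | hge
  · have h02 : M i j = 0 ∨ M i j = 2 := by omega
    rcases h02 with h0 | h2
    · simp [h0] at hcj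
      omega
    · have hn1 : n = 1 := by omega
      subst hn1
      simp [h2] at hci
  · have hs := sin_two_pi_div_pos hge
    have hn' : n < M i j := by omega
    have hc : Real.cos (Real.pi / M i j) ≠ 0 := by
      intro hc
      have h2 : 2 * Real.pi / M i j = 2 * (Real.pi / M i j) := by ring
      rw [h2, Real.sin_two_mul, hc] at hs
      simp at hs
    have hz := hcj.resolve_right hc
    have k1 := S_two_mul_real_cos (2 * Real.pi / M i j) ((n : ℤ) - 1)
    have k2 := S_two_mul_real_cos (2 * Real.pi / M i j) (n : ℤ)
    have hS : (S ℝ (n : ℤ)).eval (2 * Real.cos (2 * Real.pi / M i j)) = 1 := by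
      linarith
    have hm0 : (0 : ℝ) < M i j := by positivity
    have hsn : Real.sin (n * (Real.pi / M i j) * 2) = 0 := by
      rw [hz, zero_mul] at k1
      push_cast at k1
      rw [k1]; ring_nf
    have hcn : Real.cos (n * (Real.pi / M i j) * 2) = 1 := by
      rw [hS, one_mul] at k2
      have ha : (((n : ℤ) : ℝ) + 1) * (2 * Real.pi / M i j) =
          n * (Real.pi / M i j) * 2 + 2 * Real.pi / M i j := by push_cast; ring
      rw [ha, Real.sin_add, hsn, zero_mul, zero_add] at k2
      exact mul_right_cancel₀ hs.ne' (by rw [one_mul]; exact k2.symm)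
    have hlt : n * (Real.pi / M i j) < Real.pi := by
      have : (n : ℝ) < M i j := by exact_mod_cast hn'
      rw [← mul_div_assoc, div_lt_iff₀ hm0]
      nlinarith [Real.pi_pos]
    have hpos : 0 < n * (Real.pi / M i j) := by
      have : (0 : ℝ) < n := by exact_mod_cast hn
      have := Real.pi_pos
      positivity
    have := Real.sin_pos_of_pos_of_lt_pi hpos hlt
    rw [mul_comm _ (2 : ℝ), Real.cos_two_mul] at hcn
    nlinarith [Real.sin_sq_add_cos_sq (n * (Real.pi / M i j))]

theorem simple_mul_simple_pow_ne_one (M : CoxeterMatrix B) {i j : B} (hij : i ≠ j) {n : ℕ}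
    (hn : 0 < n) (hnm : M i j = 0 ∨ n < M i j) :
    (M.toCoxeterSystem.simple i * M.toCoxeterSystem.simple j) ^ n ≠ 1 := by
  intro h
  apply simpleReflection_mul_pow_ne_one M hij hn hnm
  have := congrArg (M.toCoxeterSystem.lift ⟨_, simpleReflection_isLiftable M⟩) h
  rw [map_pow, map_mul, CoxeterSystem.lift_apply_simple, CoxeterSystem.lift_apply_simple,
    map_one] at this
  exact this

theorem simple_injective (M : CoxeterMatrix B) :
    Function.Injective M.toCoxeterSystem.simple := by
  intro i j h
  by_contra hij
  refine simple_mul_simple_pow_ne_one M hij one_pos ?_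
    (by rw [h, pow_one, CoxeterSystem.simple_mul_simple_self])
  have := M.off_diagonal i j hij
  omega

theorem proj_gen (M : CoxeterMatrix B) (i : B) :
    proj M (gen M i) = M.toCoxeterSystem.simple i :=
  PresentedGroup.toGroup.of (braid_lift M)

theorem gen_injective (M : CoxeterMatrix B) : Function.Injective (gen M) := by
  intro i j h
  apply simple_injective M
  have := congrArg (proj M) h
  rwa [proj_gen, proj_gen] at this

end GeometricRepresentation

section Exchange

open CoxeterSystem

open scoped Classical in
/-- A simple generator acting on pairs (element, parity): it conjugates the element and flips the
parity exactly when the element is the generator itself. -/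
noncomputable def parityFun (M : CoxeterMatrix B) (i : B) :
    Function.End (M.Group × ZMod 2) := fun p =>
  (M.toCoxeterSystem.simple i * p.1 * M.toCoxeterSystem.simple i,
    p.2 + if p.1 = M.toCoxeterSystem.simple i then 1 else 0)

open scoped Classical in
theorem prod_map_parityFun (M : CoxeterMatrix B) (ω : List B) (t : M.Group) (e : ZMod 2) :
    (ω.map (parityFun M)).prod (t, e) =
      (M.toCoxeterSystem.wordProd ω * t * (M.toCoxeterSystem.wordProd ω)⁻¹,
        e + ((M.toCoxeterSystem.rightInvSeq ω).count t : ℕ)) := by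
  induction ω with
  | nil => simp [Function.End.one_def]
  | cons i ω ih =>
    rw [List.map_cons, List.prod_cons]
    change parityFun M i ((ω.map (parityFun M)).prod (t, e)) = _
    rw [ih, parityFun, wordProd_cons, rightInvSeq, List.count_cons, mul_inv_rev, inv_simple]
    refine Prod.ext (by simp only [mul_assoc]) ?_
    have hiff : M.toCoxeterSystem.wordProd ω * t * (M.toCoxeterSystem.wordProd ω)⁻¹ =
        M.toCoxeterSystem.simple i ↔ (M.toCoxeterSystem.wordProd ω)⁻¹ *
          M.toCoxeterSystem.simple i * M.toCoxeterSystem.wordProd ω = t := by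
      rw [mul_inv_eq_iff_eq_mul, mul_assoc, inv_mul_eq_iff_eq_mul, eq_comm]
    simp only [hiff, beq_iff_eq]
    push_cast
    ring

theorem prod_map_reverse_alternatingWord {G : Type*} [Monoid G] (f : B → G) (i j : B) (m : ℕ) :
    ((alternatingWord j i (2 * m)).reverse.map f).prod = (f i * f j) ^ m := by
  induction m with
  | zero => simp [alternatingWord]
  | succ m ih =>
    rw [show 2 * (m + 1) = 2 * m + 1 + 1 by ring, alternatingWord_succ, alternatingWord_succ,
      pow_succ', ← ih]
    simp [mul_assoc]

open scoped Classical in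
theorem even_count_leftInvSeq_alternatingWord (M : CoxeterMatrix B) (i j : B) (t : M.Group) :
    Even ((M.toCoxeterSystem.leftInvSeq (alternatingWord j i (2 * M i j))).count t) := by
  set L := M.toCoxeterSystem.leftInvSeq (alternatingWord j i (2 * M i j)) with hL
  have hlen : L.length = 2 * M i j := by simp [hL]
  have hhalf : L.drop (M i j) = L.take (M i j) := by
    apply List.ext_getElem
    · simp [hlen]; omega
    · intro k h1 h2
      simp only [List.length_drop, hlen] at h1
      rw [List.getElem_drop, List.getElem_take]
      simp only [hL]
      rw [getElem_leftInvSeq_alternatingWord _ _ _ _ _ (by omega),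
        getElem_leftInvSeq_alternatingWord _ _ _ _ _ (by omega),
        prod_alternatingWord_eq_mul_pow, prod_alternatingWord_eq_mul_pow]
      have e1 : (2 * (M i j + k) + 1) / 2 = M i j + k := by omega
      have e2 : (2 * k + 1) / 2 = k := by omega
      have o1 : ¬ Even (2 * (M i j + k) + 1) := by simp [parity_simps]
      have o2 : ¬ Even (2 * k + 1) := by simp [parity_simps]
      rw [e1, e2, if_neg o1, if_neg o2, pow_add, simple_mul_simple_pow, one_mul]
  rw [← List.take_append_drop (M i j) L, hhalf, List.count_append]
  exact ⟨_, rfl⟩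

theorem parityFun_isLiftable (M : CoxeterMatrix B) : M.IsLiftable (parityFun M) := by
  classical
  intro i j
  rw [← prod_map_reverse_alternatingWord]
  funext p
  obtain ⟨t, e⟩ := p
  rw [prod_map_parityFun, rightInvSeq_reverse, List.count_reverse]
  have h1 : M.toCoxeterSystem.wordProd (alternatingWord j i (2 * M i j)).reverse = 1 := by
    rw [wordProd, prod_map_reverse_alternatingWord, simple_mul_simple_pow]
  have h2 := (ZMod.natCast_eq_zero_iff_even).mpr (even_count_leftInvSeq_alternatingWord M i j t)
  rw [h1, h2]
  simp [Function.End.one_def]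

open scoped Classical in
theorem count_rightInvSeq_eq (M : CoxeterMatrix B) {ω ω' : List B}
    (h : M.toCoxeterSystem.wordProd ω = M.toCoxeterSystem.wordProd ω') (t : M.Group) :
    ((M.toCoxeterSystem.rightInvSeq ω).count t : ZMod 2) =
      (M.toCoxeterSystem.rightInvSeq ω').count t := by
  have key (ω : List B) :
      M.toCoxeterSystem.lift ⟨_, parityFun_isLiftable M⟩ (M.toCoxeterSystem.wordProd ω) =
        (ω.map (parityFun M)).prod := by
    rw [wordProd, map_list_prod, List.map_map]
    congr 2
  have h' := congrFun ((key ω).symm.trans ((congrArg _ h).trans (key ω'))) (t, 0)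
  rw [prod_map_parityFun, prod_map_parityFun] at h'
  simpa using congrArg Prod.snd h'

theorem mem_rightInvSeq_of_nodup (M : CoxeterMatrix B) {ω ω' : List B}
    (h : M.toCoxeterSystem.wordProd ω = M.toCoxeterSystem.wordProd ω')
    (hnd : (M.toCoxeterSystem.rightInvSeq ω).Nodup) {t : M.Group}
    (ht : t ∈ M.toCoxeterSystem.rightInvSeq ω) : t ∈ M.toCoxeterSystem.rightInvSeq ω' := by
  classical
  have hc := count_rightInvSeq_eq M h t
  rw [List.count_eq_one_of_mem hnd ht] at hc
  by_contra hn
  rw [List.count_eq_zero_of_not_mem hn] at hc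
  simp at hc

theorem isReduced_of_nodup_rightInvSeq (M : CoxeterMatrix B) {ω : List B}
    (hnd : (M.toCoxeterSystem.rightInvSeq ω).Nodup) : M.toCoxeterSystem.IsReduced ω := by
  classical
  obtain ⟨ω', hω', h⟩ := M.toCoxeterSystem.exists_isReduced (M.toCoxeterSystem.wordProd ω)
  refine le_antisymm (M.toCoxeterSystem.length_wordProd_le ω) ?_
  rw [h, hω'.eq]
  have hsub : (M.toCoxeterSystem.rightInvSeq ω).toFinset ⊆
      (M.toCoxeterSystem.rightInvSeq ω').toFinset := fun t ht =>
    List.mem_toFinset.mpr (mem_rightInvSeq_of_nodup M h hnd (List.mem_toFinset.mp ht))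
  have := (Finset.card_le_card hsub).trans (List.toFinset_card_le _)
  rwa [List.toFinset_card_of_nodup hnd, length_rightInvSeq, length_rightInvSeq] at this

/-- The exchange condition, on the right. -/
theorem exists_eraseIdx_of_isRightDescent (M : CoxeterMatrix B) {ω : List B} {i : B}
    (h : M.toCoxeterSystem.IsRightDescent (M.toCoxeterSystem.wordProd ω) i) :
    ∃ p < ω.length, M.toCoxeterSystem.wordProd ω * M.toCoxeterSystem.simple i =
      M.toCoxeterSystem.wordProd (ω.eraseIdx p) := by
  obtain ⟨ω', hω', h'⟩ := M.toCoxeterSystem.exists_isReduced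
    (M.toCoxeterSystem.wordProd ω * M.toCoxeterSystem.simple i)
  have hprod : M.toCoxeterSystem.wordProd (ω'.concat i) = M.toCoxeterSystem.wordProd ω := by
    rw [wordProd_concat, ← h', simple_mul_simple_cancel_right]
  have hred : M.toCoxeterSystem.IsReduced (ω'.concat i) := by
    rw [CoxeterSystem.IsReduced, hprod, ← (M.toCoxeterSystem.isRightDescent_iff).mp h, h', hω'.eq,
      List.length_concat]
  have hmem : M.toCoxeterSystem.simple i ∈ M.toCoxeterSystem.rightInvSeq ω :=
    mem_rightInvSeq_of_nodup M hprod (CoxeterSystem.IsReduced.nodup_rightInvSeq _ hred) (by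
      rw [rightInvSeq_concat]; simp)
  obtain ⟨p, hp, hpe⟩ := List.mem_iff_getElem.mp hmem
  refine ⟨p, by simpa using hp, ?_⟩
  rw [← wordProd_mul_getD_rightInvSeq, List.getD_eq_getElem _ _ hp, hpe]

/-- The exchange condition, on the left. -/
theorem exists_eraseIdx_of_isLeftDescent (M : CoxeterMatrix B) {ω : List B} {i : B}
    (h : M.toCoxeterSystem.IsLeftDescent (M.toCoxeterSystem.wordProd ω) i) :
    ∃ p < ω.length, M.toCoxeterSystem.simple i * M.toCoxeterSystem.wordProd ω =
      M.toCoxeterSystem.wordProd (ω.eraseIdx p) := by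
  rw [← isRightDescent_inv_iff, ← wordProd_reverse] at h
  obtain ⟨p, hp, hpe⟩ := exists_eraseIdx_of_isRightDescent M h
  rw [List.length_reverse] at hp
  refine ⟨ω.length - p - 1, by omega, ?_⟩
  have h2 := congrArg (·⁻¹) hpe
  simp only [mul_inv_rev, inv_simple, wordProd_reverse, inv_inv] at h2
  rw [h2, ← wordProd_reverse]
  congr 1
  rw [List.eraseIdx_eq_take_drop_succ, List.eraseIdx_eq_take_drop_succ, List.reverse_append,
    List.take_reverse, List.drop_reverse, List.reverse_reverse, List.reverse_reverse]
  congr 2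
  omega

/-- A form of the exchange condition for reduced words. -/
theorem exists_cons_eraseIdx_of_isReduced (M : CoxeterMatrix B) {ω : List B}
    (hω : M.toCoxeterSystem.IsReduced ω) {i : B}
    (h : M.toCoxeterSystem.IsLeftDescent (M.toCoxeterSystem.wordProd ω) i) :
    ∃ p < ω.length, M.toCoxeterSystem.wordProd (i :: ω.eraseIdx p) =
      M.toCoxeterSystem.wordProd ω ∧ M.toCoxeterSystem.IsReduced (i :: ω.eraseIdx p) := by
  obtain ⟨p, hp, hpe⟩ := exists_eraseIdx_of_isLeftDescent M h
  have hprod : M.toCoxeterSystem.wordProd (i :: ω.eraseIdx p) = M.toCoxeterSystem.wordProd ω := by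
    rw [wordProd_cons, ← hpe, simple_mul_simple_cancel_left]
  refine ⟨p, hp, hprod, ?_⟩
  rw [CoxeterSystem.IsReduced, hprod, hω.eq, List.length_cons, List.length_eraseIdx_add_one hp]

end Exchange

section Matsumoto

open CoxeterSystem

@[simp]
theorem length_altList (s t : B) (n : ℕ) : (altList s t n).length = n := by
  simp [altList_eq_reverse_alternatingWord]

theorem isReduced_altList (M : CoxeterMatrix B) {i j : B} (hij : i ≠ j) {k : ℕ}
    (hk : M i j = 0 ∨ k ≤ M i j) : M.toCoxeterSystem.IsReduced (altList i j k) := by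
  rw [altList_eq_reverse_alternatingWord]
  apply isReduced_of_nodup_rightInvSeq
  rw [rightInvSeq_reverse, List.nodup_reverse]
  obtain ⟨a, b, hab, hw⟩ : ∃ a b : B, ((a = i ∧ b = j) ∨ (a = j ∧ b = i)) ∧
      alternatingWord j i k = (alternatingWord a b (2 * (k + 1))).take k := by
    rcases Nat.even_or_odd k with he | ho
    · refine ⟨j, i, Or.inr ⟨rfl, rfl⟩, ?_⟩
      rw [listTake_alternatingWord _ _ _ _ (by omega), if_pos he]
    · refine ⟨i, j, Or.inl ⟨rfl, rfl⟩, ?_⟩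
      rw [listTake_alternatingWord _ _ _ _ (by omega), if_neg (Nat.not_even_iff_odd.mpr ho)]
  have hba : b ≠ a := by
    rcases hab with ⟨rfl, rfl⟩ | ⟨rfl, rfl⟩
    exacts [hij.symm, hij]
  have hm : M b a = 0 ∨ k ≤ M b a := by
    rcases hab with ⟨rfl, rfl⟩ | ⟨rfl, rfl⟩
    exacts [M.symmetric a b ▸ hk, hk]
  rw [hw, leftInvSeq_take, List.nodup_iff_injective_get]
  have hinj : ∀ p q : ℕ, p < q → q < k →
      (M.toCoxeterSystem.simple b * M.toCoxeterSystem.simple a) ^ p ≠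
        (M.toCoxeterSystem.simple b * M.toCoxeterSystem.simple a) ^ q := by
    intro p q hpq hqk h
    have h1 : (M.toCoxeterSystem.simple b * M.toCoxeterSystem.simple a) ^ (q - p) = 1 := by
      rw [pow_sub _ hpq.le, ← h, mul_inv_cancel]
    exact simple_mul_simple_pow_ne_one M hba (by omega) (by omega) h1
  rintro ⟨p, hp⟩ ⟨q, hq⟩ h
  simp only [List.length_take, length_leftInvSeq, length_alternatingWord] at hp hq
  simp only [List.get_eq_getElem, List.getElem_take] at h
  rw [getElem_leftInvSeq_alternatingWord _ _ _ _ _ (by omega),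
    getElem_leftInvSeq_alternatingWord _ _ _ _ _ (by omega),
    prod_alternatingWord_eq_mul_pow, prod_alternatingWord_eq_mul_pow] at h
  have e (n : ℕ) : (2 * n + 1) / 2 = n := by omega
  have o (n : ℕ) : ¬ Even (2 * n + 1) := by simp [parity_simps]
  rw [e, e, if_neg (o p), if_neg (o q), mul_right_inj] at h
  rw [Fin.mk.injEq]
  rcases lt_trichotomy p q with hlt | heq | hgt
  · exact absurd h (hinj p q hlt (by omega))
  · exact heq
  · exact absurd h.symm (hinj q p hgt (by omega))

/-- If a reduced word starts with an alternating prefix that is shorter than the braid word and the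
other letter is a left descent, the alternating prefix can be made longer. -/
theorem exists_longer_altList_prefix (M : CoxeterMatrix B) {i j : B} (hij : i ≠ j) {k : ℕ}
    (hk : M j i = 0 ∨ k < M j i) {r : List B}
    (hred : M.toCoxeterSystem.IsReduced (altList i j k ++ r))
    (hj : M.toCoxeterSystem.IsLeftDescent
      (M.toCoxeterSystem.wordProd (altList i j k ++ r)) j) :
    ∃ r', M.toCoxeterSystem.IsReduced (altList j i (k + 1) ++ r') ∧
      M.toCoxeterSystem.wordProd (altList j i (k + 1) ++ r') =
        M.toCoxeterSystem.wordProd (altList i j k ++ r) := by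
  obtain ⟨p, hp, hprod, hred'⟩ := exists_cons_eraseIdx_of_isReduced M hred hj
  rcases Nat.lt_or_ge p k with hlt | hge
  · exfalso
    rw [List.eraseIdx_append_of_lt_length (by simpa using hlt), ← List.cons_append,
      wordProd_append, wordProd_append, mul_left_inj, wordProd_cons] at hprod
    have h1 : M.toCoxeterSystem.wordProd (altList j i (k + 1)) =
        M.toCoxeterSystem.wordProd ((altList i j k).eraseIdx p) := by
      rw [altList, wordProd_cons, ← hprod, simple_mul_simple_cancel_left]
    have h2 := (isReduced_altList M hij.symm (k := k + 1) (by omega)).eq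
    have h3 := M.toCoxeterSystem.length_wordProd_le ((altList i j k).eraseIdx p)
    rw [← h1, h2, length_altList, List.length_eraseIdx] at h3
    simp at h3
    split_ifs at h3
    omega
  · rw [List.eraseIdx_append_of_length_le (by simpa using hge), ← List.cons_append] at hprod hred'
    exact ⟨_, hred', hprod⟩

theorem exists_altList_prefix (M : CoxeterMatrix B) {i j : B} (hij : i ≠ j) {w : M.Group}
    (hi : M.toCoxeterSystem.IsLeftDescent w i) (hj : M.toCoxeterSystem.IsLeftDescent w j)
    (k : ℕ) (hk : M i j = 0 ∨ k ≤ M i j) :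
    ∃ a b r, ((a = i ∧ b = j) ∨ (a = j ∧ b = i)) ∧
      M.toCoxeterSystem.IsReduced (altList a b k ++ r) ∧
      M.toCoxeterSystem.wordProd (altList a b k ++ r) = w := by
  induction k with
  | zero =>
    obtain ⟨r, hr, rfl⟩ := M.toCoxeterSystem.exists_isReduced w
    exact ⟨i, j, r, Or.inl ⟨rfl, rfl⟩, hr, rfl⟩
  | succ k ih =>
    obtain ⟨a, b, r, hab, hred, rfl⟩ := ih (by omega)
    have hne : a ≠ b := by
      rcases hab with ⟨rfl, rfl⟩ | ⟨rfl, rfl⟩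
      exacts [hij, hij.symm]
    have hm : M b a = M i j := by
      rcases hab with ⟨rfl, rfl⟩ | ⟨rfl, rfl⟩
      exacts [M.symmetric _ _, rfl]
    obtain ⟨r', hred', hprod'⟩ := exists_longer_altList_prefix M hne (k := k) (by omega) hred (by
      rcases hab with ⟨rfl, rfl⟩ | ⟨rfl, rfl⟩
      exacts [hj, hi])
    exact ⟨b, a, r', hab.symm.imp And.symm And.symm, hred', hprod'⟩

/-- The element of the Artin-Tits group spelled by a word. -/
def artinWord (M : CoxeterMatrix B) (l : List B) : Artin M := (l.map (gen M)).prod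

theorem artinWord_cons (M : CoxeterMatrix B) (i : B) (l : List B) :
    artinWord M (i :: l) = gen M i * artinWord M l := by
  simp [artinWord]

theorem artinWord_append (M : CoxeterMatrix B) (l l' : List B) :
    artinWord M (l ++ l') = artinWord M l * artinWord M l' := by
  simp [artinWord]

theorem proj_artinWord (M : CoxeterMatrix B) (l : List B) :
    proj M (artinWord M l) = M.toCoxeterSystem.wordProd l := by
  rw [artinWord, map_list_prod, List.map_map, wordProd]
  exact congrArg (fun f : B → M.Group => (l.map f).prod) (funext (proj_gen M))

theorem mk_prod_map_of (M : CoxeterMatrix B) (l : List B) :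
    PresentedGroup.mk (braidRels M) ((l.map FreeGroup.of).prod) = artinWord M l := by
  induction l with
  | nil => exact map_one _
  | cons i l ih => rw [List.map_cons, List.prod_cons, map_mul, ih, artinWord_cons]; rfl

theorem artinWord_altList (M : CoxeterMatrix B) {s t : B} (hst : s ≠ t) (hm : M s t ≠ 0) :
    artinWord M (altList s t (M s t)) = artinWord M (altList t s (M s t)) := by
  have h := PresentedGroup.one_of_mem (rels := braidRels M) ⟨s, t, hst, hm, rfl⟩
  rw [map_mul, map_inv, mk_prod_map_of, mk_prod_map_of] at h
  exact mul_inv_eq_one.mp h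

theorem wordProd_altList (M : CoxeterMatrix B) {s t : B} (hst : s ≠ t) (hm : M s t ≠ 0) :
    M.toCoxeterSystem.wordProd (altList s t (M s t)) =
      M.toCoxeterSystem.wordProd (altList t s (M s t)) := by
  rw [← proj_artinWord, ← proj_artinWord, artinWord_altList M hst hm]

theorem isLeftDescent_of_isReduced_cons (M : CoxeterMatrix B) {i : B} {u : List B}
    (h : M.toCoxeterSystem.IsReduced (i :: u)) :
    M.toCoxeterSystem.IsLeftDescent (M.toCoxeterSystem.wordProd (i :: u)) i := by
  rw [IsLeftDescent, h.eq, wordProd_cons, simple_mul_simple_cancel_left, List.length_cons]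
  exact Nat.lt_succ_of_le (M.toCoxeterSystem.length_wordProd_le u)

/-- Matsumoto's theorem: reduced words of the same element of the Coxeter group spell the same
element of the Artin-Tits group. -/
theorem artinWord_eq_of_isReduced (M : CoxeterMatrix B) {l l' : List B}
    (hl : M.toCoxeterSystem.IsReduced l) (hl' : M.toCoxeterSystem.IsReduced l')
    (h : M.toCoxeterSystem.wordProd l = M.toCoxeterSystem.wordProd l') :
    artinWord M l = artinWord M l' := by
  induction hn : l.length generalizing l l' with
  | zero =>
    have hlen : l'.length = 0 := by rw [← hl'.eq, ← h, hl.eq, hn]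
    rw [List.length_eq_zero_iff] at hn hlen
    rw [hn, hlen]
  | succ n ih =>
    have hlen : l'.length = n + 1 := by rw [← hl'.eq, ← h, hl.eq, hn]
    have same_head {i : B} {u v : List B} (hu : M.toCoxeterSystem.IsReduced (i :: u))
        (hv : M.toCoxeterSystem.IsReduced (i :: v)) (hun : u.length = n)
        (huv : M.toCoxeterSystem.wordProd (i :: u) = M.toCoxeterSystem.wordProd (i :: v)) :
        artinWord M (i :: u) = artinWord M (i :: v) := by
      rw [wordProd_cons, wordProd_cons, mul_right_inj] at huv
      rw [artinWord_cons, artinWord_cons, ih (l := u) (l' := v) (hu.drop 1) (hv.drop 1) huv hun]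
    obtain ⟨i, u, rfl⟩ := List.exists_cons_of_length_eq_add_one hn
    obtain ⟨j, v, rfl⟩ := List.exists_cons_of_length_eq_add_one hlen
    rw [List.length_cons, add_left_inj] at hn hlen
    rcases eq_or_ne i j with rfl | hij
    · exact same_head hl hl' hn h
    have hdi := isLeftDescent_of_isReduced_cons M hl
    have hdj := h ▸ isLeftDescent_of_isReduced_cons M hl'
    have hm : M i j ≠ 0 := by
      intro h0
      obtain ⟨a, b, r, -, hred, hprod⟩ :=
        exists_altList_prefix M hij hdi hdj (n + 2) (Or.inl h0)
      have := hred.eq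
      rw [hprod, hl.eq, List.length_append, length_altList, List.length_cons] at this
      omega
    obtain ⟨a, b, r, hab, hred, hprod⟩ :=
      exists_altList_prefix M hij hdi hdj (M i j) (Or.inr le_rfl)
    have hne : a ≠ b := by
      rcases hab with ⟨rfl, rfl⟩ | ⟨rfl, rfl⟩
      exacts [hij, hij.symm]
    have hmab : M i j = M a b := by
      rcases hab with ⟨rfl, rfl⟩ | ⟨rfl, rfl⟩
      exacts [rfl, M.symmetric _ _]
    rw [hmab] at hred hprod hm
    have hprod' : M.toCoxeterSystem.wordProd (altList b a (M a b) ++ r) =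
        M.toCoxeterSystem.wordProd (i :: u) := by
      rw [wordProd_append, ← wordProd_altList M hne hm, ← wordProd_append, hprod]
    have hred' : M.toCoxeterSystem.IsReduced (altList b a (M a b) ++ r) := by
      rw [CoxeterSystem.IsReduced, hprod', ← hprod, hred.eq]
      simp
    have hart : artinWord M (altList a b (M a b) ++ r) =
        artinWord M (altList b a (M a b) ++ r) := by
      rw [artinWord_append, artinWord_altList M hne hm, ← artinWord_append]
    obtain ⟨m, hm1⟩ := Nat.exists_eq_succ_of_ne_zero hm
    have ea : altList a b (M a b) = a :: altList b a m := by rw [hm1]; rfl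
    have eb : altList b a (M a b) = b :: altList a b m := by rw [hm1]; rfl
    rw [ea, List.cons_append] at hred hprod hart
    rw [eb, List.cons_append] at hred' hprod' hart
    rcases hab with ⟨rfl, rfl⟩ | ⟨rfl, rfl⟩
    · rw [same_head hl hred hn hprod.symm, hart,
        ← same_head hl' hred' hlen (h.symm.trans hprod'.symm)]
    · rw [same_head hl hred' hn hprod'.symm, ← hart,
        ← same_head hl' hred hlen (h.symm.trans hprod.symm)]

end Matsumoto

section Longest

open CoxeterSystem

theorem mem_posMonOn_iff (M : CoxeterMatrix B) {Z : Set B} {g : Artin M} :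
    g ∈ posMonOn M Z ↔ ∃ l : List B, (∀ i ∈ l, i ∈ Z) ∧ artinWord M l = g := by
  constructor
  · intro h
    induction h using Submonoid.closure_induction with
    | mem g hg =>
      obtain ⟨i, hi, rfl⟩ := hg
      exact ⟨[i], by simpa using hi, by simp [artinWord]⟩
    | one => exact ⟨[], by simp, rfl⟩
    | mul a b _ _ iha ihb =>
      obtain ⟨l, hl, rfl⟩ := iha
      obtain ⟨k, hk, rfl⟩ := ihb
      exact ⟨l ++ k, List.forall_mem_append.mpr ⟨hl, hk⟩, artinWord_append M l k⟩
  · rintro ⟨l, hl, rfl⟩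
    refine Submonoid.list_prod_mem _ fun g hg => ?_
    obtain ⟨i, hi, rfl⟩ := List.mem_map.mp hg
    exact Submonoid.subset_closure ⟨i, hl i hi, rfl⟩

theorem lift_const_prod_map_of {G : Type*} [Group G] (c : G) (l : List B) :
    FreeGroup.lift (fun _ => c) ((l.map FreeGroup.of).prod) = c ^ l.length := by
  rw [map_list_prod, List.map_map]
  simp [Function.comp_def]

/-- The length homomorphism from the Artin-Tits group to `ℤ`. -/
def lengthHom (M : CoxeterMatrix B) : Artin M →* Multiplicative ℤ :=
  PresentedGroup.toGroup (f := fun _ => Multiplicative.ofAdd 1) (by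
    rintro r ⟨s, t, -, -, rfl⟩
    rw [map_mul, map_inv, lift_const_prod_map_of, lift_const_prod_map_of, length_altList,
      length_altList, mul_inv_cancel])

theorem lengthHom_artinWord (M : CoxeterMatrix B) (l : List B) :
    lengthHom M (artinWord M l) = Multiplicative.ofAdd (l.length : ℤ) := by
  rw [← mk_prod_map_of]
  refine (lift_const_prod_map_of (Multiplicative.ofAdd (1 : ℤ)) l).trans ?_
  rw [← ofAdd_nsmul, nsmul_one]

theorem length_eq_of_artinWord_eq (M : CoxeterMatrix B) {l l' : List B}
    (h : artinWord M l = artinWord M l') : l.length = l'.length := by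
  have h1 := congrArg (lengthHom M) h
  rw [lengthHom_artinWord, lengthHom_artinWord] at h1
  exact_mod_cast Multiplicative.ofAdd.injective h1

theorem wordProd_eq_of_artinWord_eq (M : CoxeterMatrix B) {l l' : List B}
    (h : artinWord M l = artinWord M l') :
    M.toCoxeterSystem.wordProd l = M.toCoxeterSystem.wordProd l' := by
  rw [← proj_artinWord, h, proj_artinWord]

theorem wordProd_mem_coxSub (M : CoxeterMatrix B) {Z : Set B} {l : List B}
    (hl : ∀ i ∈ l, i ∈ Z) : M.toCoxeterSystem.wordProd l ∈ coxSub M Z := by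
  refine Subgroup.list_prod_mem _ fun g hg => ?_
  obtain ⟨i, hi, rfl⟩ := List.mem_map.mp hg
  exact Subgroup.subset_closure ⟨i, hl i hi, by rw [CoxeterMatrix.toCoxeterSystem_simple]⟩

theorem exists_isReduced_cons (M : CoxeterMatrix B) {Z : Set B} {l : List B} {i : B} (hi : i ∈ Z)
    (hl : M.toCoxeterSystem.IsReduced l) (hlZ : ∀ j ∈ l, j ∈ Z) :
    ∃ l', M.toCoxeterSystem.IsReduced l' ∧ (∀ j ∈ l', j ∈ Z) ∧
      M.toCoxeterSystem.wordProd l' =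
        M.toCoxeterSystem.simple i * M.toCoxeterSystem.wordProd l := by
  by_cases h : M.toCoxeterSystem.IsLeftDescent (M.toCoxeterSystem.wordProd l) i
  · obtain ⟨p, hp, hprod⟩ := exists_eraseIdx_of_isLeftDescent M h
    refine ⟨l.eraseIdx p, ?_, fun j hj => hlZ j (List.mem_of_mem_eraseIdx hj), hprod.symm⟩
    rw [M.toCoxeterSystem.isLeftDescent_iff] at h
    rw [CoxeterSystem.IsReduced, ← hprod, List.length_eraseIdx, if_pos hp, ← hl.eq]
    omega
  · refine ⟨i :: l, ?_, List.forall_mem_cons.mpr ⟨hi, hlZ⟩, M.toCoxeterSystem.wordProd_cons i l⟩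
    rw [M.toCoxeterSystem.not_isLeftDescent_iff] at h
    rw [CoxeterSystem.IsReduced, wordProd_cons, h, hl.eq, List.length_cons]

/-- Every element of a standard parabolic subgroup of the Coxeter group has a reduced word in the
generators of that subgroup. -/
theorem exists_isReduced_of_mem_coxSub (M : CoxeterMatrix B) {Z : Set B} {w : M.Group}
    (hw : w ∈ coxSub M Z) :
    ∃ l, M.toCoxeterSystem.IsReduced l ∧ (∀ i ∈ l, i ∈ Z) ∧
      M.toCoxeterSystem.wordProd l = w := by
  induction hw using Subgroup.closure_induction_left with
  | one => exact ⟨[], by simp [CoxeterSystem.IsReduced], by simp, by simp⟩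
  | mul_left x hx y _ ih =>
    obtain ⟨i, hi, rfl⟩ := hx
    obtain ⟨l, hl, hlZ, rfl⟩ := ih
    rw [← CoxeterMatrix.toCoxeterSystem_simple]
    exact exists_isReduced_cons M hi hl hlZ
  | inv_mul_cancel x hx y _ ih =>
    obtain ⟨i, hi, rfl⟩ := hx
    obtain ⟨l, hl, hlZ, rfl⟩ := ih
    rw [← CoxeterMatrix.toCoxeterSystem_simple, inv_simple]
    exact exists_isReduced_cons M hi hl hlZ

/-- `l` is a reduced word of the longest element of the standard parabolic subgroup `W_Z`. -/
structure IsLongestWord (M : CoxeterMatrix B) (Z : Set B) (l : List B) : Prop where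
  isReduced : M.toCoxeterSystem.IsReduced l
  mem : ∀ i ∈ l, i ∈ Z
  isLeftDescent : ∀ i ∈ Z, M.toCoxeterSystem.IsLeftDescent (M.toCoxeterSystem.wordProd l) i

theorem exists_isLongestWord (M : CoxeterMatrix B) {Z : Set B} (hZ : IsSpherical M Z) :
    ∃ l, IsLongestWord M Z l := by
  have : Finite (coxSub M Z) := hZ
  obtain ⟨⟨w, hw⟩, hmax⟩ := Finite.exists_max fun w : coxSub M Z => M.toCoxeterSystem.length w.1
  obtain ⟨l, hl, hlZ, rfl⟩ := exists_isReduced_of_mem_coxSub M hw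
  refine ⟨l, hl, hlZ, fun i hi => ?_⟩
  by_contra h
  rw [M.toCoxeterSystem.not_isLeftDescent_iff, ← wordProd_cons] at h
  have := hmax ⟨_, wordProd_mem_coxSub M (List.forall_mem_cons.mpr ⟨hi, hlZ⟩)⟩
  dsimp only at this
  omega

/-- Every reduced word over `Z` is a prefix of a reduced word of the longest element of `W_Z`. -/
theorem IsLongestWord.exists_append {M : CoxeterMatrix B} {Z : Set B} {l₀ : List B}
    (h₀ : IsLongestWord M Z l₀) {l : List B} (hl : M.toCoxeterSystem.IsReduced l)
    (hlZ : ∀ i ∈ l, i ∈ Z) :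
    ∃ k, (∀ i ∈ k, i ∈ Z) ∧ (l ++ k).length = l₀.length ∧
      artinWord M (l ++ k) = artinWord M l₀ := by
  suffices ∃ k, (∀ i ∈ k, i ∈ Z) ∧ M.toCoxeterSystem.IsReduced (l ++ k) ∧
      M.toCoxeterSystem.wordProd (l ++ k) = M.toCoxeterSystem.wordProd l₀ by
    obtain ⟨k, hkZ, hk, hprod⟩ := this
    have h := artinWord_eq_of_isReduced M hk h₀.isReduced hprod
    exact ⟨k, hkZ, length_eq_of_artinWord_eq M h, h⟩
  induction l with
  | nil => exact ⟨l₀, h₀.mem, h₀.isReduced, rfl⟩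
  | cons i l ih =>
    obtain ⟨hi, hlZ⟩ := List.forall_mem_cons.mp hlZ
    obtain ⟨k, hkZ, hk, hprod⟩ := ih (hl.drop 1) hlZ
    obtain ⟨p, hp, hprod', hred⟩ :=
      exists_cons_eraseIdx_of_isReduced M hk (hprod ▸ h₀.isLeftDescent i hi)
    rcases Nat.lt_or_ge p l.length with hlt | hge
    · exfalso
      rw [List.eraseIdx_append_of_lt_length hlt, ← List.cons_append, wordProd_append,
        wordProd_append, mul_left_inj, wordProd_cons] at hprod'
      have h1 := hl.eq
      rw [wordProd_cons, ← hprod', simple_mul_simple_cancel_left, List.length_cons] at h1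
      have h2 := M.toCoxeterSystem.length_wordProd_le (l.eraseIdx p)
      have h3 := List.length_eraseIdx_le l p
      omega
    · rw [List.eraseIdx_append_of_length_le hge, ← List.cons_append] at hprod' hred
      exact ⟨_, fun j hj => hkZ j (List.mem_of_mem_eraseIdx hj), hred, hprod'.trans hprod⟩

theorem isReduced_of_artinWord_eq (M : CoxeterMatrix B) {l l' : List B}
    (hl : M.toCoxeterSystem.IsReduced l) (h : artinWord M l' = artinWord M l) :
    M.toCoxeterSystem.IsReduced l' := by
  rw [CoxeterSystem.IsReduced, wordProd_eq_of_artinWord_eq M h, hl.eq,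
    length_eq_of_artinWord_eq M h]

theorem isReduced_singleton (M : CoxeterMatrix B) (i : B) : M.toCoxeterSystem.IsReduced [i] := by
  rw [CoxeterSystem.IsReduced, wordProd_singleton, length_simple, List.length_singleton]

/-- `Δ_Z` is spelled by the reduced words of the longest element of `W_Z`. -/
theorem IsDelta.exists_isLongestWord {M : CoxeterMatrix B} {Z : Set B} {d : Artin M}
    (hd : IsDelta M Z d) (hZ : IsSpherical M Z) :
    ∃ l, IsLongestWord M Z l ∧ artinWord M l = d := by
  obtain ⟨l₀, h₀⟩ := ArtinTitsPaper.exists_isLongestWord M hZ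
  obtain ⟨hpos, hdvd, hmin⟩ := hd
  obtain ⟨c, hc, hdc⟩ := hmin (artinWord M l₀) ((mem_posMonOn_iff M).mpr ⟨l₀, h₀.mem, rfl⟩) (by
    intro s hs
    obtain ⟨k, hkZ, -, hk⟩ := h₀.exists_append (isReduced_singleton M s) (by simpa using hs)
    exact ⟨artinWord M k, (mem_posMonOn_iff M).mpr ⟨k, hkZ, rfl⟩, by
      rw [← artinWord_cons, ← hk, List.singleton_append]⟩)
  obtain ⟨l, hlZ, rfl⟩ := (mem_posMonOn_iff M).mp hpos
  obtain ⟨k, -, rfl⟩ := (mem_posMonOn_iff M).mp hc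
  rw [← artinWord_append] at hdc
  have hl : M.toCoxeterSystem.IsReduced l := by
    simpa using (isReduced_of_artinWord_eq M h₀.isReduced hdc).take l.length
  refine ⟨l, ⟨hl, hlZ, fun i hi => ?_⟩, rfl⟩
  obtain ⟨c', hc', hic⟩ := hdvd i hi
  obtain ⟨u, -, rfl⟩ := (mem_posMonOn_iff M).mp hc'
  rw [← artinWord_cons] at hic
  rw [← wordProd_eq_of_artinWord_eq M hic]
  exact isLeftDescent_of_isReduced_cons M (isReduced_of_artinWord_eq M hl hic)

/-- `Δ_Z` quasi-centralizes `Z`. -/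
theorem IsDelta.exists_gen_mul_eq {M : CoxeterMatrix B} {Z : Set B} {d : Artin M}
    (hd : IsDelta M Z d) (hZ : IsSpherical M Z) {i : B} (hi : i ∈ Z) :
    ∃ j ∈ Z, gen M i * d = d * gen M j := by
  obtain ⟨l, hl, rfl⟩ := hd.exists_isLongestWord hZ
  obtain ⟨q, hqZ, hlen, hq⟩ := hl.exists_append (isReduced_singleton M i) (by simpa using hi)
  have hqred : M.toCoxeterSystem.IsReduced q :=
    (isReduced_of_artinWord_eq M hl.isReduced hq).drop 1
  obtain ⟨r, hrZ, hlen', hr⟩ := hl.exists_append hqred hqZ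
  have hr1 : r.length = 1 := by
    simp only [List.length_append, List.length_singleton] at hlen hlen'
    omega
  obtain ⟨j, rfl⟩ := List.length_eq_one_iff.mp hr1
  refine ⟨j, hrZ j (by simp), ?_⟩
  rw [artinWord_append] at hq hr
  nth_rewrite 1 [← hr]
  rw [← hq]
  simp [artinWord, mul_assoc]

theorem IsDelta.exists_mul_gen_eq [Finite B] {M : CoxeterMatrix B} {Z : Set B} {d : Artin M}
    (hd : IsDelta M Z d) (hZ : IsSpherical M Z) {j : B} (hj : j ∈ Z) :
    ∃ i ∈ Z, gen M i * d = d * gen M j := by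
  choose f hfZ hf using fun i : Z => hd.exists_gen_mul_eq hZ i.2
  have hinj : Function.Injective fun i : Z => (⟨f i, hfZ i⟩ : Z) := by
    intro a b hab
    have h : f a = f b := congrArg Subtype.val hab
    have h1 := (hf a).trans ((congrArg (fun x => d * gen M x) h).trans (hf b).symm)
    exact Subtype.ext (gen_injective M (mul_right_cancel h1))
  obtain ⟨i, hi⟩ := Finite.surjective_of_injective hinj ⟨j, hj⟩
  have hij : f i = j := congrArg Subtype.val hi
  exact ⟨i, i.2, by rw [hf, hij]⟩

end Longest

section Ribbon

theorem IsSpherical.mono {M : CoxeterMatrix B} {Z Z' : Set B} (h : IsSpherical M Z')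
    (hZ : Z ⊆ Z') : IsSpherical M Z :=
  have : Finite (coxSub M Z') := h
  (Set.toFinite (coxSub M Z' : Set M.Group)).subset (Subgroup.closure_mono (Set.image_mono hZ))

theorem commute_gen (M : CoxeterMatrix B) {i j : B} (h : M i j = 2) :
    Commute (gen M i) (gen M j) := by
  have hij : i ≠ j := by
    rintro rfl
    simp at h
  have h1 := artinWord_altList M hij (by omega)
  rw [h] at h1
  simpa [artinWord, altList, Commute, SemiconjBy] using h1

theorem commute_gen_of_mem_posMonOn (M : CoxeterMatrix B) {Z : Set B} {i : B}
    (hi : ∀ j ∈ Z, M j i = 2) {g : Artin M} (hg : g ∈ posMonOn M Z) : Commute g (gen M i) := by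
  induction hg using Submonoid.closure_induction with
  | mem g hg =>
    obtain ⟨j, hj, rfl⟩ := hg
    exact commute_gen M (hi j hj)
  | one => exact Commute.one_left _
  | mul a b _ _ ha hb => exact ha.mul_left hb

theorem eq_two_of_notMem_comp (M : CoxeterMatrix B) {Z : Set B} {t x : B} (hx : x ∈ Z)
    (hxC : x ∉ comp M Z t) {c : B} (hc : c ∈ comp M Z t) : M c x = 2 := by
  by_contra h
  refine hxC ⟨hx, hc.2.tail ⟨hc.1, hx, ?_, h⟩⟩
  rintro rfl
  exact hxC hc

theorem exists_gen_mul_eq_mul_gen [Finite B] (M : CoxeterMatrix B) (X : Set B) (t : B)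
    (hsph : IsSpherical M (comp M (X ∪ {t}) t)) {d : Artin M}
    (hd : (t ∈ X ∧ IsDelta M (comp M (X ∪ {t}) t) d) ∨
          (t ∉ X ∧ ∃ d₁ d₂ : Artin M, IsDelta M (comp M (X ∪ {t}) t) d₁ ∧
            IsDelta M ((comp M (X ∪ {t}) t) \ {t}) d₂ ∧ d = d₁ * d₂⁻¹))
    {x : B} (hx : x ∈ X) :
    ∃ y ∈ X ∪ {t}, gen M y * d = d * gen M x := by
  by_cases hxC : x ∈ comp M (X ∪ {t}) t
  · rcases hd with ⟨-, hd⟩ | ⟨ht, d₁, d₂, hd₁, hd₂, rfl⟩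
    · obtain ⟨y, hy, h⟩ := hd.exists_mul_gen_eq hsph hxC
      exact ⟨y, hy.1, h⟩
    · have hxt : x ≠ t := fun h => ht (h ▸ hx)
      obtain ⟨z, hz, h₂⟩ := hd₂.exists_gen_mul_eq (hsph.mono Set.sdiff_subset) ⟨hxC, hxt⟩
      obtain ⟨y, hy, h₁⟩ := hd₁.exists_mul_gen_eq hsph hz.1
      refine ⟨y, hy.1, ?_⟩
      have h₃ : gen M z * d₂⁻¹ = d₂⁻¹ * gen M x := by
        rw [mul_inv_eq_iff_eq_mul, mul_assoc, h₂, inv_mul_cancel_left]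
      rw [← mul_assoc, h₁, mul_assoc, h₃, mul_assoc]
  · have hcomm {Z : Set B} (hZ : Z ⊆ comp M (X ∪ {t}) t) {g : Artin M} (hg : g ∈ posMonOn M Z) :
        Commute g (gen M x) :=
      commute_gen_of_mem_posMonOn M
        (fun _ hj => eq_two_of_notMem_comp M (Or.inl hx) hxC (hZ hj)) hg
    refine ⟨x, Or.inl hx, ?_⟩
    rcases hd with ⟨-, hd⟩ | ⟨-, d₁, d₂, hd₁, hd₂, rfl⟩
    · exact (hcomm subset_rfl hd.1).symm.eq
    · exact ((hcomm subset_rfl hd₁.1).mul_left (hcomm Set.sdiff_subset hd₂.1).inv_left).symm.eq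

theorem leftMul_injective (M : CoxeterMatrix B) (d : Artin M) :
    Function.Injective fun Y : Set B => leftMul M Y d :=
  Set.image_injective.mpr fun _ _ h => gen_injective M (mul_right_cancel h)

end Ribbon

/-- **Definition-Lemma (Godelle).** If `X ⊆ S`, `t ∈ S` and the indecomposable component
`X(t)` of `X ∪ {t}` containing `t` is of spherical type, then for
`d = d_{X,t}` (that is `Δ_{X(t)}` if `t ∈ X`, and `Δ_{X(t)}Δ_{X(t)∖{t}}⁻¹` otherwise)
there is a unique `Y ⊆ X ∪ {t}` with `Y·d = d·X`. -/
theorem elem_ribbon_target_unique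
    [Finite B] (M : CoxeterMatrix B) (X : Set B) (t : B)
    (hsph : IsSpherical M (comp M (X ∪ {t}) t)) (d : Artin M)
    (hd : (t ∈ X ∧ IsDelta M (comp M (X ∪ {t}) t) d) ∨
          (t ∉ X ∧ ∃ d₁ d₂ : Artin M, IsDelta M (comp M (X ∪ {t}) t) d₁ ∧
            IsDelta M ((comp M (X ∪ {t}) t) \ {t}) d₂ ∧ d = d₁ * d₂⁻¹)) :
    ∃! Y : Set B, Y ⊆ X ∪ {t} ∧ leftMul M Y d = rightMul M X d := by
  have hY : leftMul M {y ∈ X ∪ {t} | gen M y * d ∈ rightMul M X d} d = rightMul M X d := by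
    apply Set.Subset.antisymm
    · rintro _ ⟨y, hy, rfl⟩
      exact hy.2
    · rintro _ ⟨x, hx, rfl⟩
      obtain ⟨y, hy, h⟩ := exists_gen_mul_eq_mul_gen M X t hsph hd hx
      exact ⟨y, ⟨hy, ⟨x, hx, h.symm⟩⟩, h⟩
  exact ⟨_, ⟨Set.sep_subset _ _, hY⟩, fun Y' h => leftMul_injective M d (h.2.trans hY.symm)⟩

end ArtinTitsPaper
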